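/- Critical points of the dual function yield feasible points: if (λ̄,μ̄) ∈ S⁺, i.e. A_r(λ̄,μ̄) is positive definite, and the Fréchet derivative of g at (λ̄,μ̄) is the zero linear map, then Ȳ = A_r(λ̄,μ̄)⁻¹ b_r(λ̄,μ̄) satisfies E_r Ȳ = e and Ȳ ∘ Ȳ = Ȳ. -/

import Mathlib

open Matrix

theorem differentiable_matrix_det {X n : Type*} [NormedAddCommGroup X] [NormedSpace ℝ X]
    [Fintype n] [DecidableEq n] {M : X → Matrix n n ℝ}
    (hM : ∀ i j, Differentiable ℝ fun x => M x i j) :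
    Differentiable ℝ fun x => (M x).det := by
  simp only [Matrix.det_apply']
  refine Differentiable.fun_sum fun σ _ => Differentiable.const_mul ?_ _
  exact fun x => (HasFDerivAt.finsetProd fun i _ =>
    (hM (σ i) i x).hasFDerivAt).differentiableAt

theorem differentiableAt_matrix_inv_apply {X n : Type*} [NormedAddCommGroup X] [NormedSpace ℝ X]
    [Fintype n] [DecidableEq n] {M : X → Matrix n n ℝ}
    (hM : ∀ i j, Differentiable ℝ fun x => M x i j) {x₀ : X} (h₀ : (M x₀).det ≠ 0) (i j : n) :
    DifferentiableAt ℝ (fun x => (M x)⁻¹ i j) x₀ := by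
  simp only [Matrix.inv_def, Ring.inverse_eq_inv', Matrix.smul_apply, smul_eq_mul,
    Matrix.adjugate_apply]
  refine DifferentiableAt.mul ((differentiable_matrix_det hM x₀).inv h₀) ?_
  refine differentiable_matrix_det (fun k l => ?_) x₀
  by_cases hk : k = j
  · subst hk
    simp
  · simpa [Matrix.updateRow_ne hk] using hM k l

theorem differentiableAt_dotProduct_inv_mulVec {X n : Type*} [NormedAddCommGroup X]
    [NormedSpace ℝ X] [Fintype n] [DecidableEq n] {M : X → Matrix n n ℝ} {v : X → n → ℝ}
    (hM : ∀ i j, Differentiable ℝ fun x => M x i j) (hv : ∀ i, Differentiable ℝ fun x => v x i)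
    {x₀ : X} (h₀ : (M x₀).det ≠ 0) :
    DifferentiableAt ℝ (fun x => v x ⬝ᵥ ((M x)⁻¹ *ᵥ v x)) x₀ := by
  simp only [dotProduct, Matrix.mulVec]
  refine DifferentiableAt.fun_sum fun i _ => (hv i x₀).mul ?_
  exact DifferentiableAt.fun_sum fun j _ =>
    (differentiableAt_matrix_inv_apply hM h₀ i j).mul (hv j x₀)

/-- Completing the square: the value of the quadratic form of `S⁻¹` at `S y + r`. -/
theorem dotProduct_inv_mulVec_add {n : Type*} [Fintype n] [DecidableEq n]
    {S : Matrix n n ℝ} (hS : S.IsSymm) (hdet : S.det ≠ 0) (y r : n → ℝ) :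
    (S *ᵥ y + r) ⬝ᵥ (S⁻¹ *ᵥ (S *ᵥ y + r))
      = 2 * ((S *ᵥ y + r) ⬝ᵥ y) - y ⬝ᵥ (S *ᵥ y) + r ⬝ᵥ (S⁻¹ *ᵥ r) := by
  have hu : IsUnit S.det := hdet.isUnit
  have h1 : S⁻¹ *ᵥ (S *ᵥ y) = y := by
    rw [Matrix.mulVec_mulVec, Matrix.nonsing_inv_mul _ hu, Matrix.one_mulVec]
  have h2 : (S *ᵥ y) ⬝ᵥ (S⁻¹ *ᵥ r) = r ⬝ᵥ y := by
    rw [← Matrix.vecMul_transpose, hS.eq, ← Matrix.dotProduct_mulVec, Matrix.mulVec_mulVec,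
      Matrix.mul_nonsing_inv _ hu, Matrix.one_mulVec, dotProduct_comm]
  rw [Matrix.mulVec_add, h1, dotProduct_add, add_dotProduct, add_dotProduct, h2,
    dotProduct_comm y]
  ring

/-- Critical points of the dual function yield feasible points: if `(λ̄,μ̄) ∈ S⁺`,
i.e. `A_r(λ̄,μ̄)` is positive definite, and the Fréchet derivative of `g` at `(λ̄,μ̄)` is the
zero linear map, then `Ȳ = A_r(λ̄,μ̄)⁻¹ b_r(λ̄,μ̄)` satisfies `E_r Ȳ = e` and `Ȳ ∘ Ȳ = Ȳ`. -/
theorem critical_point_feasible (N m : ℕ) (hN : 0 < N) (hm : 0 < m)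
    (A : Matrix (Fin N) (Fin N) ℝ) (hA : A.IsSymm)
    (b : Fin N → ℝ) (E : Matrix (Fin m) (Fin N) ℝ)
    (e : Fin m → ℝ) (he : e = fun _ => 1)
    (Alm : (Fin m → ℝ) → (Fin N → ℝ) → Matrix (Fin N) (Fin N) ℝ)
    (hAlm : ∀ lam mu, Alm lam mu = A + Matrix.diagonal mu)
    (blm : (Fin m → ℝ) → (Fin N → ℝ) → (Fin N → ℝ))
    (hblm : ∀ lam mu, blm lam mu = b + (1/2 : ℝ) • mu - Eᵀ *ᵥ lam)
    (g : (Fin m → ℝ) × (Fin N → ℝ) → ℝ)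
    (hg : ∀ p : (Fin m → ℝ) × (Fin N → ℝ), g p
      = -(1/2) * (blm p.1 p.2 ⬝ᵥ ((Alm p.1 p.2)⁻¹ *ᵥ blm p.1 p.2)) - p.1 ⬝ᵥ e)
    (lamBar : Fin m → ℝ) (muBar : Fin N → ℝ)
    (hpos : (Alm lamBar muBar).PosDef)
    (hcrit : fderiv ℝ g (lamBar, muBar) = 0)
    (Ybar : Fin N → ℝ) (hYbar : Ybar = (Alm lamBar muBar)⁻¹ *ᵥ blm lamBar muBar) :
    E *ᵥ Ybar = e ∧ Ybar * Ybar = Ybar := by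
  obtain rfl : Alm = fun _ mu => A + Matrix.diagonal mu := by
    funext lam mu
    exact hAlm lam mu
  obtain rfl : blm = fun lam mu => b + (1/2 : ℝ) • mu - Eᵀ *ᵥ lam := by
    funext lam mu
    exact hblm lam mu
  clear hAlm hblm
  obtain rfl := funext hg
  simp only at hpos hcrit hYbar
  clear hg
  have hsymm : ∀ mu : Fin N → ℝ, (A + Matrix.diagonal mu).IsSymm := fun mu =>
    hA.add (Matrix.isSymm_diagonal mu)
  have hdet : (A + Matrix.diagonal muBar).det ≠ 0 := hpos.det_pos.ne'
  have hAY : (A + Matrix.diagonal muBar) *ᵥ Ybar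
      = b + (1/2 : ℝ) • muBar - Eᵀ *ᵥ lamBar := by
    rw [hYbar, Matrix.mulVec_mulVec, Matrix.mul_nonsing_inv _ hdet.isUnit, Matrix.one_mulVec]
  have hdiag : ∀ i j, Differentiable ℝ fun mu : Fin N → ℝ => (A + Matrix.diagonal mu) i j := by
    intro i j
    by_cases hij : i = j
    · subst hij
      simp only [Matrix.add_apply, Matrix.diagonal_apply_eq]
      fun_prop
    · simp [Matrix.diagonal_apply_ne _ hij]
  have hdiff : DifferentiableAt ℝ (fun p : (Fin m → ℝ) × (Fin N → ℝ) =>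
      -(1/2) * ((b + (1/2 : ℝ) • p.2 - Eᵀ *ᵥ p.1) ⬝ᵥ ((A + Matrix.diagonal p.2)⁻¹ *ᵥ
        (b + (1/2 : ℝ) • p.2 - Eᵀ *ᵥ p.1))) - p.1 ⬝ᵥ e) (lamBar, muBar) := by
    refine DifferentiableAt.sub (DifferentiableAt.const_mul ?_ _) ?_
    · refine differentiableAt_dotProduct_inv_mulVec
        (M := fun p : (Fin m → ℝ) × (Fin N → ℝ) => A + Matrix.diagonal p.2)
        (v := fun p => b + (1/2 : ℝ) • p.2 - Eᵀ *ᵥ p.1)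
        (fun i j => (hdiag i j).comp differentiable_snd) (fun i => ?_) hdet
      simp only [Pi.add_apply, Pi.sub_apply, Pi.smul_apply, Matrix.mulVec, dotProduct]
      fun_prop
    · simp only [dotProduct]
      fun_prop
  have hfd := hdiff.hasFDerivAt
  rw [hcrit] at hfd
  have key : ∀ (dl : Fin m → ℝ) (dm : Fin N → ℝ),
      (1/2) * (Ybar ⬝ᵥ (dm * Ybar)) - ((1/2 : ℝ) • dm - Eᵀ *ᵥ dl) ⬝ᵥ Ybar - dl ⬝ᵥ e = 0 := by
    intro dl dm
    set c := (1/2) * (Ybar ⬝ᵥ (dm * Ybar)) - ((1/2 : ℝ) • dm - Eᵀ *ᵥ dl) ⬝ᵥ Ybar - dl ⬝ᵥ e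
      with hc
    set ρ : Fin N → ℝ := (1/2 : ℝ) • dm - Eᵀ *ᵥ dl - dm * Ybar with hρ
    set M : ℝ → Matrix (Fin N) (Fin N) ℝ := fun t => A + Matrix.diagonal (muBar + t • dm) with hM
    have hMd : ∀ i j, Differentiable ℝ fun t => M t i j := fun i j =>
      (hdiag i j).comp (by fun_prop : Differentiable ℝ fun t : ℝ => muBar + t • dm)
    have hM0 : (M 0).det ≠ 0 := by simpa [hM] using hdet
    have hline : HasDerivAt (fun t : ℝ => (lamBar + t • dl, muBar + t • dm)) (dl, dm) 0 := by
      refine HasDerivAt.prodMk ?_ ?_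
      · simpa using ((hasDerivAt_id (0 : ℝ)).smul_const dl).const_add lamBar
      · simpa using ((hasDerivAt_id (0 : ℝ)).smul_const dm).const_add muBar
    have hφ := HasFDerivAt.comp_hasDerivAt_of_eq (0 : ℝ) hfd hline (by simp)
    have hψ := (differentiableAt_dotProduct_inv_mulVec hMd
      (v := fun _ => ρ) (fun i => differentiable_const _) hM0).hasDerivAt
    have hψ2 := (((hasDerivAt_id (0 : ℝ)).mul_const c).const_add
      (-(1/2) * (Ybar ⬝ᵥ ((A + Matrix.diagonal muBar) *ᵥ Ybar)) - lamBar ⬝ᵥ e)).sub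
      ((((hasDerivAt_id (0 : ℝ)).pow 2).mul hψ).const_mul (1/2))
    have hev : ∀ᶠ t in nhds (0 : ℝ), (M t).det ≠ 0 :=
      (differentiable_matrix_det hMd).continuous.continuousAt.eventually_ne hM0
    have huniq := hφ.unique (hψ2.congr_of_eventuallyEq ?_)
    · simpa using huniq.symm
    · filter_upwards [hev] with t ht
      have hMt : M t *ᵥ Ybar = (A + Matrix.diagonal muBar) *ᵥ Ybar + t • (dm * Ybar) := by
        ext i
        simp [hM, Matrix.add_mulVec, Matrix.mulVec_diagonal]
        ring
      have hb : b + (1/2 : ℝ) • (muBar + t • dm) - Eᵀ *ᵥ (lamBar + t • dl)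
          = M t *ᵥ Ybar + t • ρ := by
        rw [hMt, hAY, hρ, Matrix.mulVec_add, Matrix.mulVec_smul]
        module
      have hsq := dotProduct_inv_mulVec_add (hsymm (muBar + t • dm)) ht Ybar (t • ρ)
      change -(1/2) * ((b + (1/2 : ℝ) • (muBar + t • dm) - Eᵀ *ᵥ (lamBar + t • dl)) ⬝ᵥ
        ((M t)⁻¹ *ᵥ (b + (1/2 : ℝ) • (muBar + t • dm) - Eᵀ *ᵥ (lamBar + t • dl))))
        - (lamBar + t • dl) ⬝ᵥ e
        = (-(1/2) * (Ybar ⬝ᵥ ((A + Matrix.diagonal muBar) *ᵥ Ybar)) - lamBar ⬝ᵥ e + t * c)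
          - 1/2 * (t ^ 2 * (ρ ⬝ᵥ ((M t)⁻¹ *ᵥ ρ)))
      change (M t *ᵥ Ybar + t • ρ) ⬝ᵥ ((M t)⁻¹ *ᵥ (M t *ᵥ Ybar + t • ρ))
        = 2 * ((M t *ᵥ Ybar + t • ρ) ⬝ᵥ Ybar) - Ybar ⬝ᵥ (M t *ᵥ Ybar)
          + (t • ρ) ⬝ᵥ ((M t)⁻¹ *ᵥ (t • ρ)) at hsq
      rw [hb, hsq, hMt, hc]
      have hρY : ρ ⬝ᵥ Ybar = ((1/2 : ℝ) • dm - Eᵀ *ᵥ dl) ⬝ᵥ Ybar - Ybar ⬝ᵥ (dm * Ybar) := by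
        rw [hρ, sub_dotProduct _ (dm * Ybar), dotProduct_comm (dm * Ybar)]
      simp only [add_dotProduct, dotProduct_add, smul_dotProduct, dotProduct_smul,
        Matrix.mulVec_smul, smul_eq_mul, hρY, dotProduct_comm (dm * Ybar) Ybar,
        dotProduct_comm ((A + Matrix.diagonal muBar) *ᵥ Ybar) Ybar]
      ring
  constructor
  · ext i
    have h := key (Pi.single i 1) 0
    simp only [zero_mul, dotProduct_zero, mul_zero, smul_zero, zero_sub, neg_dotProduct,
      Matrix.mulVec_transpose, ← Matrix.dotProduct_mulVec, single_one_dotProduct] at h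
    linarith
  · ext i
    have h := key 0 (Pi.single i 1)
    rw [dotProduct_comm Ybar, ← Pi.single_mul_left] at h
    simp only [Matrix.mulVec_zero, sub_zero, zero_dotProduct, smul_dotProduct,
      single_dotProduct, one_mul, smul_eq_mul] at h
    rw [Pi.mul_apply]
    linarith
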